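/- Let n = 4 and let ω = −dq¹∧dq²∧dq³∧dq⁴ + (1/3)(dq¹∧dq²∧dp₁∧dp₂ + dq³∧dq⁴∧dp₃∧dp₄) − (1/6)(dq¹∧dq³∧dp₁∧dp₃ + dq¹∧dq⁴∧dp₁∧dp₄ + dq²∧dq³∧dp₂∧dp₃ + dq²∧dq⁴∧dp₂∧dp₄) on ℝ⁹. Then: (i) ω is effective and (j¹φ)*ω = (φ₁₃φ₂₄ − φ₁₄φ₂₃ − 1)·β for every smooth φ: ℝ⁴ → ℝ, where φ_{μν} := ∂²φ/∂q^μ∂q^ν, so ω represents the first heavenly equation of Plebański φ₁₃φ₂₄ − φ₁₄φ₂₃ = 1; and (ii) there exist no smooth function L: ℝ⁹ → ℝ and no nowhere-vanishing smooth function k: ℝ⁹ → ℝ such that k·ω = E(Lβ). Hence the first heavenly equation is not the Euler–Lagrange equation of any first-order Lagrangian. -/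

import Mathlib

noncomputable section

namespace MA

/-- Points / tangent vectors of ℝ^m. -/
abbrev Vec (m : ℕ) := Fin m → ℝ

/-- An (unbundled) differential `k`-form on ℝ^m : at each point it eats a
`k`-tuple of tangent vectors and returns a real number. -/
abbrev Form (m k : ℕ) := Vec m → (Fin k → Vec m) → ℝ

/-- `ω` is pointwise an alternating multilinear map, i.e. a genuine exterior form. -/
def IsForm {m k : ℕ} (ω : Form m k) : Prop :=
  ∀ x : Vec m, ∃ a : AlternatingMap ℝ (Vec m) ℝ (Fin k), ∀ v, ω x v = a v

/-- Smoothness of a differential form (smoothness of all coefficients). -/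
def SmoothForm {m k : ℕ} (ω : Form m k) : Prop :=
  ∀ v : Fin k → Vec m, ContDiff ℝ (⊤ : ℕ∞) fun x => ω x v

/-- Multiplication of a form by a scalar function. -/
def fsmul {m k : ℕ} (f : Vec m → ℝ) (ω : Form m k) : Form m k := fun x v => f x * ω x v

/-- Wedge (exterior) product of differential forms. -/
def wedge {m k l : ℕ} (ω : Form m k) (η : Form m l) : Form m (k + l) := fun x v =>
  ((k.factorial * l.factorial : ℕ) : ℝ)⁻¹ *
    ∑ σ : Equiv.Perm (Fin (k + l)),
      ((Equiv.Perm.sign σ : ℤ) : ℝ) *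
        (ω x fun i => v (σ (Fin.castAdd l i))) *
        (η x fun j => v (σ (Fin.natAdd k j)))

/-- Interior product (contraction) of a form with a (constant) vector. -/
def iprod {m : ℕ} (u : Vec m) : ∀ {k : ℕ}, Form m k → Form m (k - 1)
  | 0, _ => 0
  | _ + 1, ω => fun x v => ω x (Fin.cons u v)

/-- Exterior derivative of a differential form (coordinate formula). -/
def exd {m k : ℕ} (ω : Form m k) : Form m (k + 1) := fun x v =>
  ∑ i : Fin (k + 1),
    (-1 : ℝ) ^ (i : ℕ) * fderiv ℝ (fun y => ω y fun j => v (i.succAbove j)) x (v i)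

/-- Change the (propositionally equal) degree of a form. -/
def reindex {m k l : ℕ} (h : k = l) (ω : Form m k) : Form m l :=
  fun x v => ω x fun i => v (Fin.cast h i)

/-- Pullback of a differential form along a map. -/
def pullback {a b k : ℕ} (f : Vec a → Vec b) (ω : Form b k) : Form a k :=
  fun x v => ω (f x) fun i => fderiv ℝ f x (v i)

/-- `i`-th standard basis vector of ℝ^m. -/
def basisVec {m : ℕ} (i : Fin m) : Vec m := Pi.single i 1

/-- The coordinate 1-form `dx^i`. -/
def dx {m : ℕ} (i : Fin m) : Form m 1 := fun _ v => v 0 i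

/-- Partial derivative of a function in the `i`-th coordinate direction. -/
def pd {m : ℕ} (i : Fin m) (f : Vec m → ℝ) : Vec m → ℝ := fun x => fderiv ℝ f x (basisVec i)

/- Jet-space coordinates on J¹ℝⁿ = ℝ^{2n+1} : (q¹,…,qⁿ,u,p₁,…,pₙ). -/

/-- Index of the coordinate `q^μ`. -/
def qIdx {n : ℕ} (μ : Fin n) : Fin (2 * n + 1) := ⟨μ, by have := μ.isLt; omega⟩

/-- Index of the coordinate `u`. -/
def uIdx {n : ℕ} : Fin (2 * n + 1) := ⟨n, by omega⟩

/-- Index of the coordinate `p_μ`. -/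
def pIdx {n : ℕ} (μ : Fin n) : Fin (2 * n + 1) := ⟨n + 1 + μ, by have := μ.isLt; omega⟩

/-- The Reeb field `χ = ∂/∂u` (a constant vector field). -/
def chi {n : ℕ} : Vec (2 * n + 1) := basisVec uIdx

/-- The standard contact form `c = du - Σ p_μ dq^μ` on J¹ℝⁿ. -/
def contact {n : ℕ} : Form (2 * n + 1) 1 := fun x v =>
  v 0 uIdx - ∑ μ : Fin n, x (pIdx μ) * v 0 (qIdx μ)

/-- The symplectic-type 2-form `Ω = dc = Σ dq^μ ∧ dp_μ`. -/
def symp {n : ℕ} : Form (2 * n + 1) 2 := ∑ μ : Fin n, wedge (dx (qIdx μ)) (dx (pIdx μ))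

/-- The bottom operator `⊥ = Σ_μ ∂_{p_μ} ⌟ ∂_{q^μ} ⌟ ·` (zero on forms of degree ≤ 1). -/
def botOp {n k : ℕ} (ω : Form (2 * n + 1) k) : Form (2 * n + 1) (k - 2) :=
  ∑ μ : Fin n, iprod (basisVec (pIdx μ)) (iprod (basisVec (qIdx μ)) ω)

/-- A form is effective if it is killed by `χ ⌟ ·` and by `⊥`. -/
def Effective {n k : ℕ} (ω : Form (2 * n + 1) k) : Prop :=
  iprod (chi (n := n)) ω = 0 ∧ botOp ω = 0

/-- The projection `p(α) = α - c ∧ (χ ⌟ α)` onto forms annihilated by `χ ⌟ ·`. -/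
def proj {n : ℕ} : ∀ {k : ℕ}, Form (2 * n + 1) k → Form (2 * n + 1) k
  | 0, α => α
  | j + 1, α => α - reindex (Nat.add_comm 1 j) (wedge contact (iprod (chi (n := n)) α))

/-- The projected exterior derivative `d_p = p ∘ d`. -/
def dproj {n k : ℕ} (ω : Form (2 * n + 1) k) : Form (2 * n + 1) (k + 1) := proj (exd ω)

/-- Lie derivative along the (constant) Reeb field `χ`. -/
def lieChi {n k : ℕ} (ω : Form (2 * n + 1) k) : Form (2 * n + 1) k := fun x v =>
  fderiv ℝ (fun y => ω y v) x (chi (n := n))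

/-- The Euler operator `E = d_p ∘ ⊥ ∘ d_p + L_χ` on n-forms over J¹ℝⁿ. -/
def euler : ∀ {n : ℕ}, Form (2 * n + 1) n → Form (2 * n + 1) n
  | 0, ω => lieChi ω
  | n + 1, ω =>
    reindex (show n + 1 + 1 - 2 + 1 = n + 1 by omega) (dproj (botOp (dproj ω))) + lieChi ω

/-- The horizontal volume form `β = dq¹ ∧ … ∧ dqⁿ` on J¹ℝⁿ. -/
def qvol {n : ℕ} : Form (2 * n + 1) n := fun _ v =>
  Matrix.det (Matrix.of fun i j : Fin n => v i (qIdx j))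

/-- The volume form `β = dq¹ ∧ … ∧ dqⁿ` on the base ℝⁿ. -/
def baseVol {n : ℕ} : Form n n := fun _ v => Matrix.det (Matrix.of fun i j : Fin n => v i j)

/-- `β_μ = ∂_{q^μ} ⌟ β`. -/
def betaMu {n : ℕ} (μ : Fin n) : Form (2 * n + 1) (n - 1) := iprod (basisVec (qIdx μ)) qvol

/-- The first jet prolongation `j¹φ : ℝⁿ → ℝ^{2n+1}`, `x ↦ (x, φ(x), ∂₁φ(x), …, ∂ₙφ(x))`. -/
def jet {n : ℕ} (φ : Vec n → ℝ) (x : Vec n) : Vec (2 * n + 1) := fun i =>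
  if h : (i : ℕ) < n then x ⟨i, h⟩
  else if h2 : (i : ℕ) = n then φ x
  else fderiv ℝ φ x (basisVec ⟨(i : ℕ) - (n + 1), by have := i.isLt; omega⟩)

/-- Second partial derivative `φ_{μν} = ∂²φ/∂q^μ∂q^ν`. -/
def d2 {n : ℕ} (φ : Vec n → ℝ) (μ ν : Fin n) : Vec n → ℝ := fun x =>
  fderiv ℝ (fun y => fderiv ℝ φ y (basisVec ν)) x (basisVec μ)

/-- A form is multisymplectic if it is closed and pointwise nondegenerate. -/
def Multisymplectic {m k : ℕ} (μ : Form m k) : Prop :=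
  exd μ = 0 ∧ ∀ (x v : Vec m), iprod v μ x = 0 → v = 0

/-- Lift a form on J¹ℝⁿ = ℝ^{2n+1} to ℝ^{2n+2} = J¹ℝⁿ × ℝ (extra coordinate `e`)
along the projection. -/
def liftForm {n k : ℕ} (ω : Form (2 * n + 1) k) : Form (2 * n + 1 + 1) k :=
  pullback (fun y (i : Fin (2 * n + 1)) => y i.castSucc) ω

/-- The 1-form `de` on ℝ^{2n+2}. -/
def deForm {n : ℕ} : Form (2 * n + 1 + 1) 1 := dx (Fin.last (2 * n + 1))

/-- The (n+1)-form `m_ω = de ∧ β + c ∧ ω` on ℝ^{2n+2}. -/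
def msf {n : ℕ} (ω : Form (2 * n + 1) n) : Form (2 * n + 1 + 1) (n + 1) :=
  reindex (Nat.add_comm 1 n) (wedge (deForm (n := n)) (liftForm qvol)) +
    reindex (Nat.add_comm 1 n) (wedge (liftForm (contact (n := n))) (liftForm ω))

/-- Wedge of four coordinate 1-forms on ℝ⁹ = J¹ℝ⁴. -/
def dd (i j k l : Fin (2 * 4 + 1)) : Form (2 * 4 + 1) 4 :=
  wedge (wedge (wedge (dx i) (dx j)) (dx k)) (dx l)

/-- The effective 4-form on ℝ⁹ representing the first heavenly equation of Plebański. -/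
def omegaP1 : Form (2 * 4 + 1) 4 :=
  -(dd (qIdx 0) (qIdx 1) (qIdx 2) (qIdx 3)) +
    (1 / 3 : ℝ) • (dd (qIdx 0) (qIdx 1) (pIdx 0) (pIdx 1) +
      dd (qIdx 2) (qIdx 3) (pIdx 2) (pIdx 3)) -
    (1 / 6 : ℝ) • (dd (qIdx 0) (qIdx 2) (pIdx 0) (pIdx 2) +
      dd (qIdx 0) (qIdx 3) (pIdx 0) (pIdx 3) +
      dd (qIdx 1) (qIdx 2) (pIdx 1) (pIdx 2) +
      dd (qIdx 1) (qIdx 3) (pIdx 1) (pIdx 3))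

/-- A tangent vector of jet space is vertical if only its `p`-components can be nonzero. -/
def IsVertical {n : ℕ} (w : Vec (2 * n + 1)) : Prop :=
  w uIdx = 0 ∧ ∀ μ : Fin n, w (qIdx μ) = 0

/-- The form `ω` vanishes as soon as at least `r` of its arguments are vertical. -/
def VanishesOnVertical {n k : ℕ} (r : ℕ) (ω : Form (2 * n + 1) k) : Prop :=
  ∀ (x : Vec (2 * n + 1)) (v : Fin k → Vec (2 * n + 1)) (S : Finset (Fin k)),
    r ≤ S.card → (∀ i ∈ S, IsVertical (v i)) → ω x v = 0

lemma isVertical_basisVec_pIdx {n : ℕ} (μ : Fin n) : IsVertical (basisVec (pIdx μ)) := by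
  refine ⟨Pi.single_eq_of_ne ?_ _, fun ν => Pi.single_eq_of_ne ?_ _⟩
  · simp only [uIdx, pIdx, ne_eq, Fin.mk.injEq]
    omega
  · simp only [qIdx, pIdx, ne_eq, Fin.mk.injEq]
    omega

lemma IsVertical.contact_eq_zero {n : ℕ} {v : Fin 1 → Vec (2 * n + 1)} (hv : IsVertical (v 0))
    (x : Vec (2 * n + 1)) : contact x v = 0 := by
  simp [contact, hv.1, hv.2]

namespace VanishesOnVertical

variable {n k r : ℕ}

lemma mono {s : ℕ} {ω : Form (2 * n + 1) k} (h : VanishesOnVertical r ω) (hrs : r ≤ s) :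
    VanishesOnVertical s ω :=
  fun x v S hS => h x v S (hrs.trans hS)

lemma qvol : VanishesOnVertical 1 (qvol (n := n)) := by
  intro x v S hS hv
  obtain ⟨i, hi⟩ := Finset.card_pos.mp hS
  exact Matrix.det_eq_zero_of_row_eq_zero i fun j => (hv i hi).2 j

lemma fsmul {ω : Form (2 * n + 1) k} (h : VanishesOnVertical r ω) (f : Vec (2 * n + 1) → ℝ) :
    VanishesOnVertical r (fsmul f ω) := by
  intro x v S hS hv
  simp [MA.fsmul, h x v S hS hv]

lemma add {ω η : Form (2 * n + 1) k} (hω : VanishesOnVertical r ω)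
    (hη : VanishesOnVertical r η) : VanishesOnVertical r (ω + η) := by
  intro x v S hS hv
  simp [hω x v S hS hv, hη x v S hS hv]

lemma sub {ω η : Form (2 * n + 1) k} (hω : VanishesOnVertical r ω)
    (hη : VanishesOnVertical r η) : VanishesOnVertical r (ω - η) := by
  intro x v S hS hv
  simp [hω x v S hS hv, hη x v S hS hv]

lemma sum {ι : Type*} {s : Finset ι} {ω : ι → Form (2 * n + 1) k}
    (h : ∀ i ∈ s, VanishesOnVertical r (ω i)) : VanishesOnVertical r (∑ i ∈ s, ω i) := by
  intro x v S hS hv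
  simp only [Finset.sum_apply]
  exact Finset.sum_eq_zero fun i hi => h i hi x v S hS hv

lemma reindex {l : ℕ} {ω : Form (2 * n + 1) k} (h : VanishesOnVertical r ω) (hkl : k = l) :
    VanishesOnVertical r (reindex hkl ω) := by
  subst hkl
  exact h

lemma lieChi {ω : Form (2 * n + 1) k} (h : VanishesOnVertical r ω) :
    VanishesOnVertical r (lieChi ω) := by
  intro x v S hS hv
  have : (fun y => ω y v) = fun _ => 0 := funext fun y => h y v S hS hv
  simp [MA.lieChi, this]

/-- If `r` arguments outside position `i` are vertical, they remain so once argument `i` is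
removed. -/
lemma apply_removeNth {ω : Form (2 * n + 1) k} (h : VanishesOnVertical r ω)
    (x : Vec (2 * n + 1)) (v : Fin (k + 1) → Vec (2 * n + 1)) (i : Fin (k + 1))
    (S : Finset (Fin (k + 1))) (hS : r ≤ (S.erase i).card) (hv : ∀ j ∈ S, IsVertical (v j)) :
    ω x (fun j => v (i.succAbove j)) = 0 := by
  refine h x _ (Finset.univ.filter fun j => i.succAbove j ∈ S) ?_ fun j hj =>
    hv _ (Finset.mem_filter.mp hj).2
  refine hS.trans ?_
  rw [← Finset.card_map i.succAboveEmb]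
  refine Finset.card_le_card fun j hj => ?_
  obtain ⟨hji, hjS⟩ := Finset.mem_erase.mp hj
  obtain ⟨l, rfl⟩ := Fin.exists_succAbove_eq hji
  simpa using hjS

lemma exd {ω : Form (2 * n + 1) k} (h : VanishesOnVertical r ω) :
    VanishesOnVertical (r + 1) (exd ω) := by
  intro x v S hS hv
  refine Finset.sum_eq_zero fun i _ => ?_
  have : (fun y => ω y fun j => v (i.succAbove j)) = fun _ => 0 := funext fun y =>
    h.apply_removeNth y v i S (by have := Finset.pred_card_le_card_erase (s := S) (a := i); omega)
      hv
  simp [this]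

lemma iprod {ω : Form (2 * n + 1) k} (h : VanishesOnVertical r ω) (u : Vec (2 * n + 1)) :
    VanishesOnVertical r (iprod u ω) := by
  intro x v S hS hv
  cases k with
  | zero => rfl
  | succ k =>
    refine h x _ (S.map (Fin.succEmb k)) (by simpa using hS) fun i hi => ?_
    obtain ⟨j, hj, rfl⟩ := Finset.mem_map.mp hi
    simpa using hv j hj

lemma iprod_of_isVertical {ω : Form (2 * n + 1) k} (h : VanishesOnVertical (r + 1) ω)
    {u : Vec (2 * n + 1)} (hu : IsVertical u) : VanishesOnVertical r (MA.iprod u ω) := by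
  intro x v S hS hv
  cases k with
  | zero => rfl
  | succ k =>
    refine h x _ (insert 0 (S.map (Fin.succEmb k))) ?_ fun i hi => ?_
    · rw [Finset.card_insert_of_notMem (by simp), Finset.card_map]
      exact Nat.succ_le_succ hS
    · obtain rfl | hi := Finset.mem_insert.mp hi
      · simpa using hu
      · obtain ⟨j, hj, rfl⟩ := Finset.mem_map.mp hi
        simpa using hv j hj

lemma wedge_contact {ω : Form (2 * n + 1) k} (h : VanishesOnVertical r ω) :
    VanishesOnVertical r (wedge contact ω) := by
  intro x v S hS hv
  refine mul_eq_zero_of_right _ (Finset.sum_eq_zero fun σ _ => ?_)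
  by_cases h0 : σ (Fin.castAdd k 0) ∈ S
  · rw [IsVertical.contact_eq_zero (v := fun i => v (σ (Fin.castAdd k i))) (hv _ h0) x]
    simp
  · refine mul_eq_zero_of_right _ (h x _ (Finset.univ.filter fun j => σ (Fin.natAdd 1 j) ∈ S)
      ?_ fun j hj => hv _ (Finset.mem_filter.mp hj).2)
    refine hS.trans ?_
    rw [← Finset.card_map ((Fin.natAddEmb 1).trans σ.toEmbedding)]
    refine Finset.card_le_card fun i hi => ?_
    obtain ⟨j, rfl⟩ := σ.surjective i
    induction j using Fin.addCases with
    | left j => exact absurd (Subsingleton.elim j 0 ▸ hi) h0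
    | right j => simpa using hi

lemma proj {ω : Form (2 * n + 1) k} (h : VanishesOnVertical r ω) :
    VanishesOnVertical r (proj ω) := by
  cases k with
  | zero => exact h
  | succ k => exact h.sub ((h.iprod chi).wedge_contact.reindex _)

lemma dproj {ω : Form (2 * n + 1) k} (h : VanishesOnVertical r ω) :
    VanishesOnVertical (r + 1) (dproj ω) :=
  h.exd.proj

lemma botOp {ω : Form (2 * n + 1) k} (h : VanishesOnVertical (r + 1) ω) :
    VanishesOnVertical r (botOp ω) :=
  sum fun μ _ => (h.iprod _).iprod_of_isVertical (isVertical_basisVec_pIdx μ)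

lemma euler {ω : Form (2 * n + 1) n} (h : VanishesOnVertical r ω) :
    VanishesOnVertical (r + 1) (euler ω) := by
  cases n with
  | zero => exact h.lieChi.mono r.le_succ
  | succ n => exact (h.dproj.botOp.dproj.reindex _).add (h.lieChi.mono r.le_succ)

end VanishesOnVertical

/-- The decomposable form `dx^{I 0} ∧ … ∧ dx^{I (k - 1)}`, as a determinant. -/
def coordForm {m k : ℕ} (I : Fin k → Fin m) : Form m k := fun _ v =>
  Matrix.det (Matrix.of fun a b : Fin k => v a (I b))

lemma dx_eq_coordForm {m : ℕ} (i : Fin m) : dx i = coordForm ![i] := by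
  ext x v
  simp [dx, coordForm]

lemma wedge_coordForm {m k l : ℕ} (I : Fin k → Fin m) (J : Fin l → Fin m) :
    wedge (coordForm I) (coordForm J) = coordForm (Fin.append I J) := by
  ext x v
  let e (τ : Equiv.Perm (Fin k) × Equiv.Perm (Fin l)) : Equiv.Perm (Fin (k + l)) :=
    finSumFinEquiv.permCongr (τ.1.sumCongr τ.2)
  have hl (τ) (a : Fin k) : e τ (Fin.castAdd l a) = Fin.castAdd l (τ.1 a) := by simp [e]
  have hr (τ) (b : Fin l) : e τ (Fin.natAdd k b) = Fin.natAdd k (τ.2 b) := by simp [e]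
  have hsign (τ) : Equiv.Perm.sign (e τ) = Equiv.Perm.sign τ.1 * Equiv.Perm.sign τ.2 := by
    simp [e, Equiv.Perm.sign_permCongr, Equiv.Perm.sign_sumCongr]
  have hterm (σ : Equiv.Perm (Fin (k + l))) :
      ((Equiv.Perm.sign σ : ℤ) : ℝ) *
        (coordForm I x fun i => v (σ (Fin.castAdd l i))) *
        (coordForm J x fun j => v (σ (Fin.natAdd k j))) =
      ∑ τ : Equiv.Perm (Fin k) × Equiv.Perm (Fin l),
        ((Equiv.Perm.sign (σ * e τ) : ℤ) : ℝ) *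
          ∏ c, v ((σ * e τ) c) (Fin.append I J c) := by
    simp only [coordForm, Matrix.det_apply', Matrix.of_apply]
    rw [mul_assoc, Finset.sum_mul_sum, ← Fintype.sum_prod_type', Finset.mul_sum]
    refine Finset.sum_congr rfl fun τ _ => ?_
    simp only [Fin.prod_univ_add, Equiv.Perm.mul_apply, hl, hr, Fin.append_left,
      Fin.append_right, Equiv.Perm.sign_mul, hsign, Units.val_mul, Int.cast_mul]
    ring
  have hdet (τ) : ∑ σ : Equiv.Perm (Fin (k + l)), ((Equiv.Perm.sign (σ * e τ) : ℤ) : ℝ) *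
      ∏ c, v ((σ * e τ) c) (Fin.append I J c) = coordForm (Fin.append I J) x v := by
    rw [coordForm, Matrix.det_apply']
    exact Equiv.sum_comp (Equiv.mulRight (e τ)) fun σ : Equiv.Perm (Fin (k + l)) =>
      ((Equiv.Perm.sign σ : ℤ) : ℝ) * ∏ c, v (σ c) (Fin.append I J c)
  simp only [wedge, hterm]
  rw [Finset.sum_comm]
  simp only [hdet, Finset.sum_const, Finset.card_univ, Fintype.card_prod, Fintype.card_perm,
    Fintype.card_fin, nsmul_eq_mul]
  rw [inv_mul_cancel_left₀]
  positivity

lemma dd_eq_coordForm (i j k l : Fin (2 * 4 + 1)) : dd i j k l = coordForm ![i, j, k, l] := by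
  simp only [dd, dx_eq_coordForm, wedge_coordForm]
  congr 1
  ext a
  fin_cases a <;> rfl

lemma coordForm_four_apply {m : ℕ} (i j k l : Fin m) (x : Vec m) (v : Fin 4 → Vec m) :
    coordForm ![i, j, k, l] x v =
      v 0 i * (v 1 j * (v 2 k * v 3 l - v 2 l * v 3 k)
        - v 1 k * (v 2 j * v 3 l - v 2 l * v 3 j)
        + v 1 l * (v 2 j * v 3 k - v 2 k * v 3 j))
      - v 0 j * (v 1 i * (v 2 k * v 3 l - v 2 l * v 3 k)
        - v 1 k * (v 2 i * v 3 l - v 2 l * v 3 i)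
        + v 1 l * (v 2 i * v 3 k - v 2 k * v 3 i))
      + v 0 k * (v 1 i * (v 2 j * v 3 l - v 2 l * v 3 j)
        - v 1 j * (v 2 i * v 3 l - v 2 l * v 3 i)
        + v 1 l * (v 2 i * v 3 j - v 2 j * v 3 i))
      - v 0 l * (v 1 i * (v 2 j * v 3 k - v 2 k * v 3 j)
        - v 1 j * (v 2 i * v 3 k - v 2 k * v 3 i)
        + v 1 k * (v 2 i * v 3 j - v 2 j * v 3 i)) := by
  rw [coordForm, Matrix.det_succ_row_zero]
  simp [Fin.sum_univ_succ, Matrix.det_fin_three, Fin.succAbove]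
  ring

lemma coordForm_fderiv {m n : ℕ} (f : Vec n → Vec m) (I : Fin n → Fin m) (x : Vec n)
    (v : Fin n → Vec n) :
    coordForm I (f x) (fun a => fderiv ℝ f x (v a)) =
      coordForm I (f x) (fun c => fderiv ℝ f x (basisVec c)) * baseVol x v := by
  rw [mul_comm, coordForm, coordForm, baseVol, ← Matrix.det_mul]
  congr 1
  ext a b
  have h := LinearMap.pi_apply_eq_sum_univ (fderiv ℝ f x).toLinearMap (v a)
  simp only [ContinuousLinearMap.coe_coe] at h
  simp only [Matrix.of_apply, Matrix.mul_apply, h, Finset.sum_apply, Pi.smul_apply, smul_eq_mul]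
  refine Finset.sum_congr rfl fun c _ => ?_
  rw [show (fun j => if c = j then (1 : ℝ) else 0) = basisVec c from
    funext fun j => by simp [basisVec, Pi.single_apply, eq_comm]]

lemma jet_qIdx {n : ℕ} (φ : Vec n → ℝ) (x : Vec n) (μ : Fin n) : jet φ x (qIdx μ) = x μ := by
  simp [jet, qIdx]

lemma jet_pIdx {n : ℕ} (φ : Vec n → ℝ) (x : Vec n) (μ : Fin n) :
    jet φ x (pIdx μ) = fderiv ℝ φ x (basisVec μ) := by
  have h : ¬ n + 1 + (μ : ℕ) < n := by omega
  have h' : ¬ n + 1 + (μ : ℕ) = n := by omega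
  simp [jet, pIdx, h, h']

section Prolongation

variable {n : ℕ} {φ : Vec n → ℝ}

lemma differentiable_fderiv_apply (hφ : ContDiff ℝ (⊤ : ℕ∞) φ) (w : Vec n) :
    Differentiable ℝ fun x => fderiv ℝ φ x w :=
  (((contDiff_infty.1 hφ 2).fderiv_right (m := 1) (by norm_num)).differentiable one_ne_zero).clm_apply
    (differentiable_const w)

lemma differentiable_jet (hφ : ContDiff ℝ (⊤ : ℕ∞) φ) : Differentiable ℝ (jet φ) := by
  refine differentiable_pi.2 fun i => ?_
  unfold jet
  split_ifs
  · fun_prop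
  · exact hφ.differentiable (by simp)
  · exact differentiable_fderiv_apply hφ _

lemma fderiv_jet_qIdx (hφ : ContDiff ℝ (⊤ : ℕ∞) φ) (x w : Vec n) (μ : Fin n) :
    fderiv ℝ (jet φ) x w (qIdx μ) = w μ := by
  have h := DFunLike.congr_fun (fderiv_apply (differentiable_jet hφ x) (qIdx μ)) w
  simp only [jet_qIdx] at h
  rw [fderiv_apply differentiableAt_id] at h
  simpa using h.symm

lemma fderiv_jet_pIdx (hφ : ContDiff ℝ (⊤ : ℕ∞) φ) (x : Vec n) (μ ν : Fin n) :
    fderiv ℝ (jet φ) x (basisVec ν) (pIdx μ) = d2 φ ν μ x := by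
  have h := DFunLike.congr_fun (fderiv_apply (differentiable_jet hφ x) (pIdx μ)) (basisVec ν)
  simp only [jet_pIdx] at h
  simpa [d2] using h.symm

lemma d2_comm (hφ : ContDiff ℝ (⊤ : ℕ∞) φ) (μ ν : Fin n) (x : Vec n) :
    d2 φ μ ν x = d2 φ ν μ x := by
  have hd : DifferentiableAt ℝ (fderiv ℝ φ) x :=
    ((contDiff_infty.1 hφ 2).fderiv_right (m := 1) (by norm_num)).differentiable one_ne_zero x
  have key (α β : Fin n) :
      d2 φ α β x = fderiv ℝ (fderiv ℝ φ) x (basisVec α) (basisVec β) := by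
    rw [d2, fderiv_clm_apply hd (differentiableAt_const _)]
    simp
  rw [key, key]
  exact (contDiff_infty.1 hφ 2).contDiffAt.isSymmSndFDerivAt (by simp) _ _

end Prolongation

lemma effective_omegaP1 : Effective omegaP1 := by
  constructor
  · ext x w
    simp [iprod, omegaP1, dd_eq_coordForm, coordForm_four_apply, chi, basisVec, uIdx, qIdx, pIdx,
      Fin.ext_iff]
  · ext x w
    have h : botOp omegaP1 x w =
        ∑ μ : Fin 4, omegaP1 x ![basisVec (qIdx μ), basisVec (pIdx μ), w 0, w 1] := by
      simp only [botOp, Finset.sum_apply]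
      refine Finset.sum_congr rfl fun μ _ => congrArg (omegaP1 x) ?_
      ext i j
      fin_cases i <;> rfl
    rw [h]
    simp [omegaP1, dd_eq_coordForm, coordForm_four_apply, Fin.sum_univ_four,
      basisVec, qIdx, pIdx, Pi.single_apply]
    ring

lemma pullback_jet_omegaP1 {φ : Vec 4 → ℝ} (hφ : ContDiff ℝ (⊤ : ℕ∞) φ) :
    pullback (jet φ) omegaP1 =
      fsmul (fun x => d2 φ 0 2 x * d2 φ 1 3 x - d2 φ 0 3 x * d2 φ 1 2 x - 1) baseVol := by
  ext x v
  have h (i j k l) := coordForm_fderiv (jet φ) ![i, j, k, l] x v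
  simp only [pullback, fsmul, omegaP1, dd_eq_coordForm, Pi.add_apply, Pi.sub_apply, Pi.neg_apply,
    Pi.smul_apply, smul_eq_mul, h]
  simp only [coordForm_four_apply, fderiv_jet_qIdx hφ, fderiv_jet_pIdx hφ]
  simp [basisVec]
  rw [d2_comm hφ 1 0, d2_comm hφ 2 0, d2_comm hφ 3 0, d2_comm hφ 2 1, d2_comm hφ 3 1,
    d2_comm hφ 3 2]
  ring


/-- the displayed effective 4-form represents the first heavenly equation of
Plebański `φ₁₃φ₂₄ − φ₁₄φ₂₃ = 1`, and this equation is not the Euler–Lagrange equation of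
any first-order Lagrangian. -/
theorem plebanski_first_heavenly_not_variational :
    (Effective omegaP1 ∧
      ∀ φ : Vec 4 → ℝ, ContDiff ℝ (⊤ : ℕ∞) φ →
        pullback (jet φ) omegaP1 =
          fsmul (fun x => d2 φ 0 2 x * d2 φ 1 3 x - d2 φ 0 3 x * d2 φ 1 2 x - 1) baseVol) ∧
    ¬ ∃ (L k : Vec (2 * 4 + 1) → ℝ), ContDiff ℝ (⊤ : ℕ∞) L ∧ ContDiff ℝ (⊤ : ℕ∞) k ∧ (∀ x, k x ≠ 0) ∧
        fsmul k omegaP1 = euler (fsmul L qvol) := by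
  refine ⟨⟨effective_omegaP1, fun φ hφ => pullback_jet_omegaP1 hφ⟩, ?_⟩
  rintro ⟨L, k, -, -, hk, h⟩
  let v : Fin 4 → Vec (2 * 4 + 1) :=
    ![basisVec (qIdx 0), basisVec (qIdx 1), basisVec (pIdx 0), basisVec (pIdx 1)]
  have hzero : euler (fsmul L qvol) 0 v = 0 := by
    refine (VanishesOnVertical.qvol.fsmul L).euler 0 v {2, 3} (by simp) ?_
    simp [v, isVertical_basisVec_pIdx]
  have hω : omegaP1 0 v = 1 / 3 := by
    simp [v, omegaP1, dd_eq_coordForm, coordForm_four_apply, basisVec, qIdx, pIdx]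
  rw [← h, fsmul, hω] at hzero
  exact hk 0 (by linarith)


end MA
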